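/- arXiv:hep-th/0211136 — 3 statements merged into one kernel-verified Lean document; each statement's English description precedes it below -/
import Mathlib

section
/- Let V = LaurentSeries ℂ be the ℂ-algebra of formal Laurent series (Hahn series over ℤ with complex coefficients), and let R : V → V be the minimal-subtraction projection onto the pole part, defined on coefficients by (R f)(n) = f(n) for n < 0 and (R f)(n) = 0 for n ≥ 0. Then R is a well-defined ℂ-linear map and satisfies the Rota–Baxter relation R(x)R(y) + R(xy) = R(R(x)y) + R(xR(y)) for all x, y ∈ V. -/
/-- A product coefficient of Hahn series may be computed over any partially well-ordered sets
containing the supports of the factors. -/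
theorem HahnSeries.coeff_mul_of_support_subset {Γ R : Type*} [AddCommMonoid Γ] [PartialOrder Γ]
    [IsOrderedCancelAddMonoid Γ] [NonUnitalNonAssocSemiring R] {x y : HahnSeries Γ R} {s t : Set Γ}
    (hs : s.IsPWO) (ht : t.IsPWO) (hx : x.support ⊆ s) (hy : y.support ⊆ t) (a : Γ) :
    (x * y).coeff a =
      ∑ ij ∈ Finset.antidiagonal hs ht a, x.coeff ij.1 * y.coeff ij.2 := by
  rw [HahnSeries.coeff_mul]
  refine Finset.sum_subset (fun ij hij => ?_) (fun ij hij hnot => ?_)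
  · rw [Finset.mem_antidiagonal] at hij ⊢
    exact ⟨hx hij.1, hy hij.2.1, hij.2.2⟩
  · rw [Finset.mem_antidiagonal] at hij hnot
    by_contra h
    exact hnot ⟨left_ne_zero_of_mul h, right_ne_zero_of_mul h, hij.2.2⟩

/-- Minimal subtraction (projection onto the pole part) is a well-defined
`ℂ`-linear map on formal Laurent series and is a Rota–Baxter operator. -/
theorem minimalSubtraction_rotaBaxter :
    ∃ R : LaurentSeries ℂ →ₗ[ℂ] LaurentSeries ℂ,
      (∀ (f : LaurentSeries ℂ) (n : ℤ),
        (R f).coeff n = if n < 0 then f.coeff n else 0) ∧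
      (∀ x y : LaurentSeries ℂ,
        R x * R y + R (x * y) = R (R x * y) + R (x * R y)) := by
  have hcoeff (f : LaurentSeries ℂ) (n : ℤ) :
      (HahnSeries.truncLTLinearMap ℂ (0 : ℤ) f).coeff n = if n < 0 then f.coeff n else 0 :=
    HahnSeries.coeff_truncLT 0 f n
  refine ⟨HahnSeries.truncLTLinearMap ℂ (0 : ℤ), hcoeff, fun x y => ?_⟩
  ext n
  have hx : (HahnSeries.truncLTLinearMap ℂ (0 : ℤ) x).support ⊆ x.support :=
    HahnSeries.support_truncLT_subset 0 x
  have hy : (HahnSeries.truncLTLinearMap ℂ (0 : ℤ) y).support ⊆ y.support :=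
    HahnSeries.support_truncLT_subset 0 y
  have hmul {u v : LaurentSeries ℂ} (hu : u.support ⊆ x.support) (hv : v.support ⊆ y.support) :=
    HahnSeries.coeff_mul_of_support_subset x.isPWO_support y.isPWO_support hu hv n
  rw [HahnSeries.coeff_add, HahnSeries.coeff_add, hcoeff, hcoeff, hcoeff, hmul hx hy,
    hmul subset_rfl subset_rfl, hmul hx subset_rfl, hmul subset_rfl hy]
  simp only [hcoeff]
  split_ifs with hn
  · rw [← Finset.sum_add_distrib, ← Finset.sum_add_distrib]
    refine Finset.sum_congr rfl fun ij hij => ?_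
    have hsum := (Finset.mem_antidiagonal.mp hij).2.2
    split_ifs <;> first | omega | ring
  · rw [add_zero, add_zero]
    refine Finset.sum_eq_zero fun ij hij => ?_
    have hsum := (Finset.mem_antidiagonal.mp hij).2.2
    split_ifs <;> first | omega | simp
end

section
/- The shuffle product is associative at the multiset level: for any three lists A, B, C over a type α, (shuffles A B).bind (fun D => shuffles D C) = (shuffles B C).bind (fun D => shuffles A D) as multisets of lists. -/
/-- The multiset of shuffles (interleavings) of two lists. -/
def shuffles {α : Type*} : List α → List α → Multiset (List α)
  | [], B => {B}
  | A, [] => {A}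
  | a :: A, b :: B =>
      ((shuffles A (b :: B)).map (a :: ·)) + ((shuffles (a :: A) B).map (b :: ·))
  termination_by A B => A.length + B.length
  decreasing_by all_goals simp

theorem shuffles_nil_left {α : Type*} (B : List α) : shuffles [] B = {B} := by
  rw [shuffles]

theorem shuffles_nil_right {α : Type*} (A : List α) : shuffles A [] = {A} := by
  cases A <;> simp [shuffles]

theorem shuffles_cons_cons {α : Type*} (a b : α) (A B : List α) :
    shuffles (a :: A) (b :: B) =
      (shuffles A (b :: B)).map (a :: ·) + (shuffles (a :: A) B).map (b :: ·) := by
  rw [shuffles]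

/-- A threefold shuffle of nonempty lists, split by the list that supplies the first letter. -/
theorem shuffles_cons_cons_bind_shuffles_cons {α : Type*} (a b c : α) (A B C : List α) :
    (shuffles (a :: A) (b :: B)).bind (fun D => shuffles D (c :: C)) =
      ((shuffles A (b :: B)).bind (fun D => shuffles D (c :: C))).map (a :: ·) +
        ((shuffles (a :: A) B).bind (fun D => shuffles D (c :: C))).map (b :: ·) +
        ((shuffles (a :: A) (b :: B)).bind (fun D => shuffles D C)).map (c :: ·) := by
  simp only [shuffles_cons_cons a b, Multiset.add_bind, Multiset.bind_map, shuffles_cons_cons _ c,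
    Multiset.bind_add, Multiset.map_add, Multiset.map_bind]
  abel

/-- The version of `shuffles_cons_cons_bind_shuffles_cons` for the other bracketing. -/
theorem shuffles_cons_cons_bind_cons_shuffles {α : Type*} (a b c : α) (A B C : List α) :
    (shuffles (b :: B) (c :: C)).bind (fun D => shuffles (a :: A) D) =
      ((shuffles (b :: B) (c :: C)).bind (fun D => shuffles A D)).map (a :: ·) +
        ((shuffles B (c :: C)).bind (fun D => shuffles (a :: A) D)).map (b :: ·) +
        ((shuffles (b :: B) C).bind (fun D => shuffles (a :: A) D)).map (c :: ·) := by
  simp only [shuffles_cons_cons b c, Multiset.add_bind, Multiset.bind_map, shuffles_cons_cons a,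
    Multiset.bind_add, Multiset.map_add, Multiset.map_bind]
  abel

/-- The shuffle product is associative at the multiset level. -/
theorem shuffles_assoc {α : Type*} (A B C : List α) :
    (shuffles A B).bind (fun D => shuffles D C) =
      (shuffles B C).bind (fun D => shuffles A D) := by
  match A, B, C with
  | [], B, C => simpa [shuffles_nil_left] using (Multiset.bind_singleton (shuffles B C) id).symm
  | A, [], C => simp [shuffles_nil_left, shuffles_nil_right]
  | A, B, [] => simpa [shuffles_nil_right] using Multiset.bind_singleton (shuffles A B) id
  | a :: A, b :: B, c :: C =>
    rw [shuffles_cons_cons_bind_shuffles_cons, shuffles_cons_cons_bind_cons_shuffles,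
      shuffles_assoc A (b :: B) (c :: C), shuffles_assoc (a :: A) B (c :: C),
      shuffles_assoc (a :: A) (b :: B) C]
termination_by A.length + B.length + C.length
decreasing_by all_goals simp only [List.length_cons]; omega
end

section
/- Fix s ∈ ℂ and for a list J of prime numbers define φ_s(J) := ((∏_{p ∈ J} p : ℂ) ^ (−s)) / (J.length)! (complex power of the positive integer given by the product of the entries of J, divided by the factorial of the length). Then φ_s is multiplicative with respect to the shuffle product: for any two lists J₁, J₂ of primes, the sum of φ_s over the multiset shuffles J₁ J₂ (with multiplicity) equals φ_s(J₁) · φ_s(J₂). -/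
open scoped Nat

/-- Every shuffle of `A` and `B` is a permutation of their concatenation. -/
theorem perm_append_of_mem_shuffles {α : Type*} (A B : List α) :
    ∀ J ∈ shuffles A B, J.Perm (A ++ B) := by
  induction A, B using shuffles.induct with
  | case1 B => simp [shuffles]
  | case2 A h => cases A <;> simp [shuffles]
  | case3 a A b B ihA ihB =>
    intro J hJ
    rw [shuffles, Multiset.mem_add, Multiset.mem_map, Multiset.mem_map] at hJ
    rcases hJ with ⟨K, hK, rfl⟩ | ⟨K, hK, rfl⟩
    · exact (ihA K hK).cons a
    · exact ((ihB K hK).cons b).trans List.perm_middle.symm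

/-- The number of shuffles of two lists is a binomial coefficient. -/
theorem card_shuffles {α : Type*} (A B : List α) :
    (shuffles A B).card = (A.length + B.length).choose A.length := by
  induction A, B using shuffles.induct with
  | case1 B => simp [shuffles]
  | case2 A h => cases A <;> simp [shuffles]
  | case3 a A b B ihA ihB =>
    rw [shuffles, Multiset.card_add, Multiset.card_map, Multiset.card_map, ihA, ihB]
    simp only [List.length_cons]
    rw [show A.length + 1 + (B.length + 1) = (A.length + (B.length + 1)) + 1 by ring,
      Nat.choose_succ_succ, show A.length + 1 + B.length = A.length + (B.length + 1) by ring]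

/-- The "Feynman rules" φ_s(J) = w(J)^(−s)/|J|! on sequences of primes are
multiplicative with respect to the shuffle product. -/
theorem phi_multiplicative_on_shuffles (s : ℂ) (J₁ J₂ : List ℕ)
    (h₁ : ∀ p ∈ J₁, Nat.Prime p) (h₂ : ∀ p ∈ J₂, Nat.Prime p) :
    ((shuffles J₁ J₂).map
        (fun J => ((J.prod : ℂ) ^ (-s)) / (J.length ! : ℂ))).sum =
      (((J₁.prod : ℂ) ^ (-s)) / (J₁.length ! : ℂ)) *
      (((J₂.prod : ℂ) ^ (-s)) / (J₂.length ! : ℂ)) := by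
  have h : ∀ J ∈ shuffles J₁ J₂, ((J.prod : ℂ) ^ (-s)) / (J.length ! : ℂ) =
      ((J₁.prod : ℂ) ^ (-s) * (J₂.prod : ℂ) ^ (-s)) / ((J₁.length + J₂.length)! : ℂ) := by
    intro J hJ
    have hp := perm_append_of_mem_shuffles J₁ J₂ J hJ
    rw [hp.prod_eq, hp.length_eq, List.prod_append, List.length_append, Nat.cast_mul,
      Complex.natCast_mul_natCast_cpow]
  rw [Multiset.map_congr rfl h, Multiset.map_const', Multiset.sum_replicate, card_shuffles,
    nsmul_eq_mul, Nat.cast_add_choose ℂ]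
  have h₀ (n : ℕ) : (n ! : ℂ) ≠ 0 := Nat.cast_ne_zero.mpr n.factorial_ne_zero
  have := h₀ J₁.length
  have := h₀ J₂.length
  have := h₀ (J₁.length + J₂.length)
  field_simp
end
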